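/- arXiv:1403.6096 — 5 statements merged into one kernel-verified Lean document; each statement's English description precedes it below -/
import Mathlib

section
/- Let σ = (λ₁,...,λ₅) be a list of complex numbers with u(σ) = -e₂(σ) - λ₂² - λ₅² ≠ 0. Then the characteristic polynomial of the 5×5 symmetric matrix A(σ) equals (z-λ₁)(z-λ₂)(z-λ₃)(z-λ₄)(z-λ₅), i.e., the spectrum of A(σ) is σ. -/
open Polynomial

/-- Principal square root of a complex number. -/
noncomputable def csqrt (z : ℂ) : ℂ := z ^ ((1 : ℂ) / 2)

/-- The matrix pattern `A(σ)` of the paper. -/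
noncomputable def patternA (l1 l2 l3 l4 l5 : ℂ) : Matrix (Fin 5) (Fin 5) ℂ :=
  let e1 : ℂ := l1 + l2 + l3 + l4 + l5
  let e2 : ℂ := l1*l2+l1*l3+l1*l4+l1*l5+l2*l3+l2*l4+l2*l5+l3*l4+l3*l5+l4*l5
  let e3 : ℂ := l1*l2*l3+l1*l2*l4+l1*l2*l5+l1*l3*l4+l1*l3*l5+l1*l4*l5+l2*l3*l4+l2*l3*l5+l2*l4*l5+l3*l4*l5
  let u : ℂ := -e2 - l2^2 - l5^2
  let v : ℂ := -(l3 + l5) * (l4 + l5) * (l2 + l4) * (l2 + l3) * (l1 + l2) * (l1 + l5)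
  let w : ℂ := l2 * l5 * e1 - l1 * l3 * l4
  let r : ℂ := e3 + e1 * (l2^2 + l5^2)
  (1 / (2 * u)) •
    !![2*u*e1, 0, csqrt (2*u^3), 0, csqrt (2*u^3);
       0, 0, 0, 2*w, 2*csqrt v;
       csqrt (2*u^3), 0, 0, 2*csqrt v, 2*r;
       0, 2*w, 2*csqrt v, 0, 0;
       csqrt (2*u^3), 2*csqrt v, 2*r, 0, 0]

/-- The square of the principal square root of `z` is `z`. -/
lemma csqrt_sq (z : ℂ) : csqrt z ^ 2 = z := by
  simp [csqrt]

/-- The characteristic polynomial of a symmetric matrix with the zero pattern of `patternA`. -/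
lemma charpoly_pattern {R : Type*} [CommRing R] (a p b c d : R) :
    (!![a, 0, p, 0, p;
        0, 0, 0, b, c;
        p, 0, 0, c, d;
        0, b, c, 0, 0;
        p, c, d, 0, 0] : Matrix (Fin 5) (Fin 5) R).charpoly =
      X ^ 5 - C a * X ^ 4 - C (2 * c ^ 2 + d ^ 2 + b ^ 2 + 2 * p ^ 2) * X ^ 3
        + C (a * (2 * c ^ 2 + d ^ 2 + b ^ 2) - 2 * p ^ 2 * d) * X ^ 2
        + C ((d * b - c ^ 2) ^ 2 + 2 * p ^ 2 * (b ^ 2 + c ^ 2)) * X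
        + C (2 * p ^ 2 * (b * (d * b - c ^ 2)) - a * (d * b - c ^ 2) ^ 2) := by
  have hchar : (!![a, 0, p, 0, p;
        0, 0, 0, b, c;
        p, 0, 0, c, d;
        0, b, c, 0, 0;
        p, c, d, 0, 0] : Matrix (Fin 5) (Fin 5) R).charmatrix =
      !![X - C a, 0, -C p, 0, -C p;
         0, X, 0, -C b, -C c;
         -C p, 0, X, -C c, -C d;
         0, -C b, -C c, X, 0;
         -C p, -C c, -C d, 0, X] := by
    ext1 i j
    fin_cases i <;> fin_cases j <;> simp
  rw [Matrix.charpoly, hchar]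
  simp [Matrix.det_succ_row_zero, Fin.sum_univ_succ, Fin.succAbove]
  rw [show (C 2 : R[X]) = 2 from rfl]
  ring

theorem stmt0 (l1 l2 l3 l4 l5 : ℂ)
    (hu : -(l1*l2+l1*l3+l1*l4+l1*l5+l2*l3+l2*l4+l2*l5+l3*l4+l3*l5+l4*l5) - l2^2 - l5^2 ≠ 0) :
    (patternA l1 l2 l3 l4 l5).charpoly =
      (X - C l1) * (X - C l2) * (X - C l3) * (X - C l4) * (X - C l5) := by
  unfold patternA
  extract_lets e1 e2 e3 u v w r
  have hu0 : u ≠ 0 := hu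
  have hrw : r * w - v = u ^ 2 * (l2 * l5) := by
    simp only [r, w, v, u, e1, e2, e3]; ring
  have hwv : w ^ 2 + v = u * (l1*l2*l3*l4 + l1*l2*l3*l5 + l1*l2*l4*l5 + l1*l3*l4*l5 + l2*l3*l4*l5
      - (l2 * l5) ^ 2) := by
    simp only [w, v, u, e1, e2]; ring
  have hq : 2 * v + r ^ 2 + w ^ 2 = u ^ 2 * (l2 ^ 2 + l5 ^ 2) := by
    simp only [r, w, v, u, e1, e2, e3]; ring
  have hp : 2 * (csqrt (2 * u ^ 3) / (2 * u)) ^ 2 = u := by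
    rw [div_pow, csqrt_sq]; field_simp
  have hc : (csqrt v / u) ^ 2 = v / u ^ 2 := by rw [div_pow, csqrt_sq]
  have hM : (1 / (2 * u)) •
      !![2*u*e1, 0, csqrt (2*u^3), 0, csqrt (2*u^3);
         0, 0, 0, 2*w, 2*csqrt v;
         csqrt (2*u^3), 0, 0, 2*csqrt v, 2*r;
         0, 2*w, 2*csqrt v, 0, 0;
         csqrt (2*u^3), 2*csqrt v, 2*r, 0, 0] =
      !![e1, 0, csqrt (2*u^3) / (2*u), 0, csqrt (2*u^3) / (2*u);
         0, 0, 0, w / u, csqrt v / u;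
         csqrt (2*u^3) / (2*u), 0, 0, csqrt v / u, r / u;
         0, w / u, csqrt v / u, 0, 0;
         csqrt (2*u^3) / (2*u), csqrt v / u, r / u, 0, 0] := by
    ext i j
    fin_cases i <;> fin_cases j <;> simp <;> field_simp
  have hdet : r / u * (w / u) - v / u ^ 2 = l2 * l5 := by
    field_simp; linear_combination hrw
  have hsum : 2 * (v / u ^ 2) + (r / u) ^ 2 + (w / u) ^ 2 = l2 ^ 2 + l5 ^ 2 := by
    field_simp; linear_combination hq
  have hwv' : u * ((w / u) ^ 2 + v / u ^ 2) = l1*l2*l3*l4 + l1*l2*l3*l5 + l1*l2*l4*l5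
      + l1*l3*l4*l5 + l2*l3*l4*l5 - (l2 * l5) ^ 2 := by
    field_simp; linear_combination hwv
  rw [hM, charpoly_pattern, hp, hc, hdet, hsum, hwv', mul_div_cancel₀ _ hu0, ← mul_assoc,
    mul_div_cancel₀ _ hu0]
  simp only [r, w, u, e1, e2, e3, map_add, map_sub, map_mul, map_pow, map_neg]
  ring
end

section
/- Let σ = (λ₁,...,λ₅) be a list of real numbers satisfying λ₁ ≥ λ₂ ≥ λ₃ ≥ λ₄ ≥ λ₅ > -λ₁, λ₁+λ₂+λ₃+λ₄+λ₅ ≥ 0, λ₃ > λ₁+λ₂+λ₃+λ₄+λ₅, and e₃(σ) + e₁(σ)(λ₂²+λ₅²) ≥ 0. Then there exists a 5×5 symmetric nonnegative real matrix whose multiset of eigenvalues is {λ₁, λ₂, λ₃, λ₄, λ₅}. -/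
open Polynomial

/-- The determinant of `t - A` for a symmetric bordering `A` of a bipartite `4 × 4` matrix whose
two off-diagonal blocks are persymmetric. -/
theorem det_sub_bordered (t d a b P Q R : ℝ) :
    (Matrix.scalar (Fin 5) t -
      !![d, a, b, b, a; a, 0, 0, P, Q; b, 0, 0, R, P; b, P, R, 0, 0; a, Q, P, 0, 0]).det =
    (t - d) * ((t ^ 2 - (2 * P ^ 2 + Q ^ 2 + R ^ 2)) * t ^ 2 + (P ^ 2 - Q * R) ^ 2)
      - 2 * (t ^ 2 * (t * (a ^ 2 + b ^ 2) + (2 * a * b * P + a ^ 2 * Q + b ^ 2 * R))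
        - t * ((a * P - b * Q) ^ 2 + (a * R - b * P) ^ 2)
        - (P ^ 2 - Q * R) * (2 * a * b * P - b ^ 2 * Q - a ^ 2 * R)) := by
  simp [Matrix.det_succ_row_zero, Fin.sum_univ_succ, Fin.succAbove, Matrix.scalar_apply,
    Matrix.submatrix_apply, Matrix.diagonal_apply]
  ring

theorem exists_bordered_of_interlacing (d m n x y : ℝ) (hd : 0 ≤ d) (hn : 0 ≤ n) (hnm : n ≤ m)
    (hx : 0 ≤ x) (hy : 0 < y) (hxy : n * x ^ 2 ≤ m * y ^ 2) :
    ∃ A : Matrix (Fin 5) (Fin 5) ℝ, A.IsSymm ∧ (∀ i j, 0 ≤ A i j) ∧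
      ∀ t, A.charpoly.eval t =
        (t - n) * (t + m) * ((t - d) * (t + n) * (t - m) - x ^ 2 * (t - m) - y ^ 2 * (t + n)) := by
  suffices h : ∃ a b P Q R : ℝ, 0 ≤ a ∧ 0 ≤ b ∧ 0 ≤ P ∧ 0 ≤ Q ∧ 0 ≤ R ∧
      ∀ t : ℝ, (t - d) * ((t ^ 2 - (2 * P ^ 2 + Q ^ 2 + R ^ 2)) * t ^ 2 + (P ^ 2 - Q * R) ^ 2)
      - 2 * (t ^ 2 * (t * (a ^ 2 + b ^ 2) + (2 * a * b * P + a ^ 2 * Q + b ^ 2 * R))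
        - t * ((a * P - b * Q) ^ 2 + (a * R - b * P) ^ 2)
        - (P ^ 2 - Q * R) * (2 * a * b * P - b ^ 2 * Q - a ^ 2 * R)) =
        (t - n) * (t + m) *
          ((t - d) * (t + n) * (t - m) - x ^ 2 * (t - m) - y ^ 2 * (t + n)) by
    obtain ⟨a, b, P, Q, R, ha, hb, hP, hQ, hR, h⟩ := h
    refine ⟨!![d, a, b, b, a; a, 0, 0, P, Q; b, 0, 0, R, P; b, P, R, 0, 0; a, Q, P, 0, 0],
      ?_, ?_, ?_⟩
    · ext i j
      fin_cases i <;> fin_cases j <;> rfl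
    · intro i j
      fin_cases i <;> fin_cases j <;> simp [*]
    · intro t
      rw [Matrix.eval_charpoly, det_sub_bordered, h]
  have hm : 0 ≤ m := hn.trans hnm
  rcases le_total x y with hle | hle
  · refine ⟨(y - x) / 2, (y + x) / 2, (m + n) / 2, (m - n) / 2, (m - n) / 2,
      by linarith, by positivity, by positivity, by linarith, by linarith, ?_⟩
    intro t
    ring
  · have hr : 0 < x ^ 2 + y ^ 2 := by positivity
    have hsq : y ^ 2 ≤ x ^ 2 := by gcongr
    refine ⟨0, √((x ^ 2 + y ^ 2) / 2), (m + n) * x * y / (x ^ 2 + y ^ 2),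
      (m * x ^ 2 - n * y ^ 2) / (x ^ 2 + y ^ 2), (m * y ^ 2 - n * x ^ 2) / (x ^ 2 + y ^ 2),
      le_rfl, Real.sqrt_nonneg _, by positivity,
      div_nonneg (sub_nonneg.2 (mul_le_mul hnm hsq (sq_nonneg y) hm)) hr.le,
      div_nonneg (sub_nonneg.2 hxy) hr.le, ?_⟩
    intro t
    simp only [zero_mul, mul_zero, zero_sub, zero_add, zero_pow two_ne_zero, neg_sq, mul_pow,
      Real.sq_sqrt (half_pos hr).le]
    field_simp
    ring

theorem stmt5 (l1 l2 l3 l4 l5 : ℝ)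
    (h12 : l1 ≥ l2) (h23 : l2 ≥ l3) (h34 : l3 ≥ l4) (h45 : l4 ≥ l5) (h5 : l5 > -l1)
    (htrace : l1 + l2 + l3 + l4 + l5 ≥ 0)
    (h3 : l3 > l1 + l2 + l3 + l4 + l5)
    (hr : (l1*l2*l3+l1*l2*l4+l1*l2*l5+l1*l3*l4+l1*l3*l5+l1*l4*l5+l2*l3*l4+l2*l3*l5+l2*l4*l5+l3*l4*l5)
        + (l1 + l2 + l3 + l4 + l5) * (l2^2 + l5^2) ≥ 0) :
    ∃ A : Matrix (Fin 5) (Fin 5) ℝ, A.IsSymm ∧ (∀ i j, 0 ≤ A i j) ∧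
      A.charpoly = (X - C l1) * (X - C l2) * (X - C l3) * (X - C l4) * (X - C l5) := by
  have hD : 0 < l2 - l5 := by linarith
  have hx : 0 ≤ (l1 + l2) * (l2 + l3) * (-l2 - l4) / (l2 - l5) :=
    div_nonneg (mul_nonneg (mul_nonneg (by linarith) (by linarith)) (by linarith)) hD.le
  have hy : 0 < (l1 + l5) * ((-l5 - l3) * (-l5 - l4)) / (l2 - l5) :=
    div_pos (mul_pos (by linarith) (mul_pos (by linarith) (by linarith))) hD
  have hX := Real.sq_sqrt hx
  have hY := Real.sq_sqrt hy.le
  obtain ⟨A, hA, hA0, h⟩ := exists_bordered_of_interlacing (l1 + l2 + l3 + l4 + l5) (-l5) l2 _ _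
    htrace (by linarith) (by linarith) (Real.sqrt_nonneg _) (Real.sqrt_pos.2 hy) (by
      rw [hX, hY, ← sub_nonneg]
      convert hr using 1
      field_simp
      ring)
  refine ⟨A, hA, hA0, Polynomial.funext fun t => ?_⟩
  rw [h, hX, hY]
  simp only [eval_mul, eval_sub, eval_X, eval_C]
  field_simp
  ring
end

section
/- Let σ = (λ₁,...,λ₅) be a decreasing list of reals with λ₅ ≥ -λ₁ and λ₃ ≤ λ₁+λ₂+λ₃+λ₄+λ₅, realizable as the spectrum of a 5×5 symmetric nonnegative matrix. Then for any s > 0 and any i ∈ {2,3,4,5}, the list σᵢ^{-s} obtained by replacing λ₁ by λ₁+s and λᵢ by λᵢ-s is realizable by a 5×5 symmetric nonnegative matrix, and likewise σᵢ^{+s} (replacing λᵢ by λᵢ+s). -/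
open Polynomial

/-- `μ` is the spectrum of a 5×5 symmetric nonnegative matrix. -/
def SymRealizable5 (μ : Fin 5 → ℝ) : Prop :=
  ∃ A : Matrix (Fin 5) (Fin 5) ℝ, A.IsSymm ∧ (∀ i j, 0 ≤ A i j) ∧
    A.charpoly = ∏ j, (X - C (μ j))

open Matrix

theorem roots_eq_of_charpoly {A : Matrix (Fin 5) (Fin 5) ℝ} {μ : Fin 5 → ℝ}
    (hchar : A.charpoly = ∏ j, (X - C (μ j))) :
    A.charpoly.roots = Multiset.map μ Finset.univ.val := by
  rw [hchar, Polynomial.roots_prod]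
  · simp
  · simp [Finset.prod_ne_zero_iff, Polynomial.X_sub_C_ne_zero]

/-- The eigenvalues of a real symmetric matrix with charpoly `∏ j, (X - C (μ j))`, `μ` antitone,
are realized by an orthonormal eigenbasis indexed like `μ`. -/
theorem exists_orthonormal_eigenbasis {A : Matrix (Fin 5) (Fin 5) ℝ} {μ : Fin 5 → ℝ}
    (hA : A.IsSymm) (hμ : Antitone μ) (hchar : A.charpoly = ∏ j, (X - C (μ j))) :
    ∃ b : OrthonormalBasis (Fin 5) ℝ (EuclideanSpace ℝ (Fin 5)),
      ∀ i, A *ᵥ ⇑(b i) = μ i • ⇑(b i) := by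
  have hH : A.IsHermitian := isHermitian_iff_isSymm.2 hA
  have hsort : (A.charpoly.roots.map RCLike.re).sort (· ≥ ·) = List.ofFn μ := by
    simp_rw [roots_eq_of_charpoly hchar, Fin.univ_val_map, Multiset.map_coe, List.map_ofFn,
      Function.comp_def, RCLike.re_to_real, Multiset.coe_sort]
    apply List.mergeSort_of_pairwise
    simp_rw [decide_eq_true_eq, ← List.sortedGE_iff_pairwise]
    exact hμ.sortedGE_ofFn
  have heig : hH.eigenvalues₀ = μ :=
    List.ofFn_injective (hH.sort_roots_charpoly_eq_eigenvalues₀.symm.trans hsort)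
  let e : Fin 5 ≃ Fin 5 :=
    (Fintype.equivOfCardEq (Fintype.card_fin _) : Fin (Fintype.card (Fin 5)) ≃ Fin 5)
  refine ⟨hH.eigenvectorBasis.reindex e.symm, fun i ↦ ?_⟩
  have hi : hH.eigenvalues (e i) = μ i := by
    rw [← heig]
    exact congrArg hH.eigenvalues₀ (e.symm_apply_apply i)
  rw [OrthonormalBasis.reindex_apply, Equiv.symm_symm, hH.mulVec_eigenvectorBasis, hi]

theorem OrthonormalBasis.dotProduct_eq_ite {n : ℕ}
    (b : OrthonormalBasis (Fin n) ℝ (EuclideanSpace ℝ (Fin n))) (i j : Fin n) :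
    ⇑(b i) ⬝ᵥ ⇑(b j) = if i = j then 1 else 0 := by
  have h := b.inner_eq_ite j i
  rw [EuclideanSpace.inner_eq_star_dotProduct] at h
  simpa [eq_comm] using h

/-- Rayleigh's lower bound for the quadratic form of a symmetric matrix. -/
theorem mul_dotProduct_self_le {n : ℕ} {A : Matrix (Fin n) (Fin n) ℝ} {μ : Fin n → ℝ} {m : ℝ}
    (hA : A.IsSymm) (b : OrthonormalBasis (Fin n) ℝ (EuclideanSpace ℝ (Fin n)))
    (hb : ∀ i, A *ᵥ ⇑(b i) = μ i • ⇑(b i)) (hm : ∀ i, m ≤ μ i) (z : Fin n → ℝ) :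
    m * (z ⬝ᵥ z) ≤ z ⬝ᵥ (A *ᵥ z) := by
  have key (w : Fin n → ℝ) : z ⬝ᵥ w = ∑ i, (⇑(b i) ⬝ᵥ z) * (⇑(b i) ⬝ᵥ w) := by
    have h := b.sum_inner_mul_inner (WithLp.toLp 2 z) (WithLp.toLp 2 w)
    simp only [EuclideanSpace.inner_eq_star_dotProduct, star_trivial] at h
    rw [dotProduct_comm z w, ← h]
    exact Finset.sum_congr rfl fun i _ ↦ by rw [dotProduct_comm w]
  have hAz (i : Fin n) : ⇑(b i) ⬝ᵥ (A *ᵥ z) = μ i * (⇑(b i) ⬝ᵥ z) := by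
    rw [dotProduct_mulVec, ← mulVec_transpose, hA.eq, hb, smul_dotProduct, smul_eq_mul]
  rw [key z, key (A *ᵥ z), Finset.mul_sum]
  refine Finset.sum_le_sum fun i _ ↦ ?_
  rw [hAz]
  nlinarith [mul_nonneg (sub_nonneg.2 (hm i)) (mul_self_nonneg (⇑(b i) ⬝ᵥ z))]

/-- A vector supported on two indices whose Rayleigh quotient is at least `l` forces
`l + m ≤ trace A`, where `m` bounds all Rayleigh quotients from below. -/
theorem add_le_trace_of_support_pair {n : ℕ} {A : Matrix (Fin n) (Fin n) ℝ} {l m : ℝ}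
    (hnn : ∀ i j, 0 ≤ A i j) (hm : ∀ z : Fin n → ℝ, m * (z ⬝ᵥ z) ≤ z ⬝ᵥ (A *ᵥ z))
    {y : Fin n → ℝ} (hy : y ≠ 0) (hl : l * (y ⬝ᵥ y) ≤ y ⬝ᵥ (A *ᵥ y))
    {i j : Fin n} (hij : i ≠ j) (hsupp : ∀ k, k ≠ i → k ≠ j → y k = 0) :
    l + m ≤ A.trace := by
  have hy' : y = Pi.single i (y i) + Pi.single j (y j) := by
    ext k
    by_cases hki : k = i
    · subst hki; simp [hij]
    · by_cases hkj : k = j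
      · subst hkj; simp [hki]
      · simp [hki, hkj, hsupp k hki hkj]
  have hm' := hm (Pi.single i (y j) + Pi.single j (-y i))
  have hpos : 0 < y i * y i + y j * y j := by
    by_contra! h
    have hi : y i = 0 := by nlinarith [mul_self_nonneg (y i), mul_self_nonneg (y j)]
    have hj : y j = 0 := by nlinarith [mul_self_nonneg (y i), mul_self_nonneg (y j)]
    exact hy (by rw [hy', hi, hj]; simp)
  have htr : A i i + A j j ≤ A.trace := by
    rw [← Finset.sum_pair (f := fun k ↦ A k k) hij]
    exact Finset.sum_le_sum_of_subset_of_nonneg (Finset.subset_univ _) fun k _ _ ↦ hnn k k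
  generalize y i = p at *
  generalize y j = q at *
  subst hy'
  simp [mulVec_add, add_dotProduct, hij, hij.symm] at hl hm'
  have hsum : (l + m) * (p * p + q * q) ≤ (A i i + A j j) * (p * p + q * q) := by linarith
  exact (le_of_mul_le_mul_right hsum hpos).trans htr

/-- Two nonzero vectors with disjoint supports in dimension five: one has support of size at
most two. -/
theorem exists_pair_of_disjoint_supports {x y : Fin 5 → ℝ} (h : ∀ k, x k * y k = 0) :
    ∃ i j : Fin 5, i ≠ j ∧
      ((∀ k, k ≠ i → k ≠ j → x k = 0) ∨ (∀ k, k ≠ i → k ≠ j → y k = 0)) := by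
  have key : ∀ s : Fin 5 → Bool, ∃ i j : Fin 5, i ≠ j ∧
      ((∀ k, k ≠ i → k ≠ j → s k = true) ∨ (∀ k, k ≠ i → k ≠ j → s k = false)) := by
    decide
  classical
  obtain ⟨i, j, hij, hs⟩ := key fun k ↦ decide (x k = 0)
  refine ⟨i, j, hij, hs.imp (fun hs k hi hj ↦ by simpa using hs k hi hj) fun hs k hi hj ↦ ?_⟩
  have := hs k hi hj
  exact (mul_eq_zero.1 (h k)).resolve_left (by simpa using this)

theorem add_le_trace_of_disjoint_supports {A : Matrix (Fin 5) (Fin 5) ℝ} {l m : ℝ}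
    (hnn : ∀ i j, 0 ≤ A i j) (hm : ∀ z : Fin 5 → ℝ, m * (z ⬝ᵥ z) ≤ z ⬝ᵥ (A *ᵥ z))
    {x y : Fin 5 → ℝ} (hx : x ≠ 0) (hy : y ≠ 0) (hxy : ∀ k, x k * y k = 0)
    (hlx : l * (x ⬝ᵥ x) ≤ x ⬝ᵥ (A *ᵥ x)) (hly : l * (y ⬝ᵥ y) ≤ y ⬝ᵥ (A *ᵥ y)) :
    l + m ≤ A.trace := by
  obtain ⟨i, j, hij, h | h⟩ := exists_pair_of_disjoint_supports hxy
  · exact add_le_trace_of_support_pair hnn hm hx hlx hij h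
  · exact add_le_trace_of_support_pair hnn hm hy hly hij h

/-- The positive part of an eigenvector of a nonnegative matrix has large Rayleigh quotient. -/
theorem mul_dotProduct_posPart_le {n : ℕ} {A : Matrix (Fin n) (Fin n) ℝ} {l : ℝ}
    (hnn : ∀ i j, 0 ≤ A i j) {w : Fin n → ℝ} (hw : A *ᵥ w = l • w) :
    l * (w⁺ ⬝ᵥ w⁺) ≤ w⁺ ⬝ᵥ (A *ᵥ w⁺) := by
  have hdecomp : w⁺ = w + w⁻ := by rw [← sub_eq_iff_eq_add, posPart_sub_negPart]
  have hdisj : w⁺ ⬝ᵥ w⁻ = 0 := by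
    refine Finset.sum_eq_zero fun k _ ↦ ?_
    simp only [Pi.posPart_apply, Pi.negPart_apply]
    rcases le_total (w k) 0 with h | h
    · simp [posPart_eq_zero.2 h]
    · simp [negPart_eq_zero.2 h]
  have hcross : 0 ≤ w⁺ ⬝ᵥ (A *ᵥ w⁻) :=
    Finset.sum_nonneg fun i _ ↦ mul_nonneg (posPart_nonneg w i) <|
      show 0 ≤ A i ⬝ᵥ w⁻ from
        Finset.sum_nonneg fun j _ ↦ mul_nonneg (hnn i j) (negPart_nonneg w j)
  have h1 : A *ᵥ w⁺ = l • w + A *ᵥ w⁻ := by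
    rw [← hw, ← mulVec_add, ← hdecomp]
  have h2 : w⁺ ⬝ᵥ w = w⁺ ⬝ᵥ w⁺ := by
    conv_rhs => rw [hdecomp, dotProduct_add, ← hdecomp, hdisj, add_zero]
  rw [h1, dotProduct_add, dotProduct_smul, smul_eq_mul, h2]
  linarith

/-- For a symmetric nonnegative `5 × 5` matrix, `λ₂ + λ₅ ≤ trace`. -/
theorem second_add_last_le_trace {A : Matrix (Fin 5) (Fin 5) ℝ} {μ : Fin 5 → ℝ}
    (hA : A.IsSymm) (hnn : ∀ i j, 0 ≤ A i j) (hμ : Antitone μ)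
    (hchar : A.charpoly = ∏ j, (X - C (μ j))) :
    μ 1 + μ 4 ≤ A.trace := by
  obtain ⟨b, hb⟩ := exists_orthonormal_eigenbasis hA hμ hchar
  have hm := mul_dotProduct_self_le hA b hb (m := μ 4) fun i ↦ hμ (Fin.le_last i)
  have h10 : μ 1 ≤ μ 0 := hμ (Fin.zero_le _)
  have hunit (i : Fin 5) : ⇑(b i) ⬝ᵥ ⇑(b i) = 1 := by simp [b.dotProduct_eq_ite]
  have signed (l : ℝ) (hl : μ 1 ≤ l) (w : Fin 5 → ℝ) (hw : A *ᵥ w = l • w) (hww : w ⬝ᵥ w = 1) :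
      μ 1 + μ 4 ≤ A.trace ∨ ∃ v : Fin 5 → ℝ, 0 ≤ v ∧ A *ᵥ v = l • v ∧ v ⬝ᵥ v = 1 ∧
        (v = w ∨ v = -w) := by
    have hneg : A *ᵥ (-w) = l • (-w) := by rw [mulVec_neg, hw, smul_neg]
    by_cases hp : w⁺ = 0
    · exact .inr ⟨-w, neg_nonneg.2 (posPart_eq_zero.1 hp), hneg, by simpa using hww, .inr rfl⟩
    by_cases hn : w⁻ = 0
    · exact .inr ⟨w, negPart_eq_zero.1 hn, hw, hww, .inl rfl⟩
    left
    have hle : ∀ z : Fin 5 → ℝ, l * (z ⬝ᵥ z) ≤ z ⬝ᵥ (A *ᵥ z) →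
        μ 1 * (z ⬝ᵥ z) ≤ z ⬝ᵥ (A *ᵥ z) := fun z hz ↦
      (mul_le_mul_of_nonneg_right hl (Finset.sum_nonneg fun k _ ↦ mul_self_nonneg (z k))).trans hz
    refine add_le_trace_of_disjoint_supports hnn hm hp hn (fun k ↦ ?_)
      (hle _ (mul_dotProduct_posPart_le hnn hw)) (hle _ ?_)
    · simp only [Pi.posPart_apply, Pi.negPart_apply]
      rcases le_total (w k) 0 with h | h
      · simp [posPart_eq_zero.2 h]
      · simp [negPart_eq_zero.2 h]
    · simpa using mul_dotProduct_posPart_le hnn hneg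
  rcases signed (μ 0) h10 _ (hb 0) (hunit 0) with h | ⟨u, hu, hAu, huu, hu'⟩
  · exact h
  rcases signed (μ 1) le_rfl _ (hb 1) (hunit 1) with h | ⟨v, hv, hAv, hvv, hv'⟩
  · exact h
  have horth : u ⬝ᵥ v = 0 := by
    have h01 : ⇑(b 0) ⬝ᵥ ⇑(b 1) = 0 := by simp [b.dotProduct_eq_ite]
    rcases hu' with rfl | rfl <;> rcases hv' with rfl | rfl <;> simp [h01]
  refine add_le_trace_of_disjoint_supports hnn hm (x := u) (y := v) ?_ ?_ (fun k ↦ ?_) ?_ ?_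
  · rintro rfl; simp at huu
  · rintro rfl; simp at hvv
  · exact (Finset.sum_eq_zero_iff_of_nonneg fun k _ ↦ mul_nonneg (hu k) (hv k)).1 horth k
      (Finset.mem_univ k)
  · rw [hAu, dotProduct_smul, huu]; simpa using h10
  · rw [hAv, dotProduct_smul, hvv]; simp

theorem trace_eq_sum_of_charpoly {A : Matrix (Fin 5) (Fin 5) ℝ} {μ : Fin 5 → ℝ}
    (hchar : A.charpoly = ∏ j, (X - C (μ j))) : A.trace = ∑ j, μ j := by
  rw [trace_eq_sum_roots_charpoly_of_splits, roots_eq_of_charpoly hchar]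
  · rfl
  · rw [hchar]
    exact Polynomial.Splits.prod fun i _ ↦ Polynomial.Splits.X_sub_C _

/-- Conjugating a diagonal matrix by an orthogonal one keeps the spectrum. -/
theorem charpoly_mul_diagonal_mul_transpose {n : ℕ} {Q : Matrix (Fin n) (Fin n) ℝ}
    (hQ : Qᵀ * Q = 1) (d : Fin n → ℝ) :
    (Q * diagonal d * Qᵀ).charpoly = ∏ j, (X - C (d j)) := by
  rw [charpoly_mul_comm, ← Matrix.mul_assoc, hQ, Matrix.one_mul, charpoly_diagonal]

/-- The orthogonal matrix used to glue a `3 × 3` and a `2 × 2` block. -/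
noncomputable def gluingMatrix (x y p q h : ℝ) : Matrix (Fin 5) (Fin 5) ℝ :=
  !![p * h * x, q * h * x, h * y, h, 0;
     p * h * x, q * h * x, h * y, -h, 0;
     p * y, q * y, -x, 0, 0;
     q * h, -(p * h), 0, 0, h;
     q * h, -(p * h), 0, 0, -h]

theorem gluingMatrix_transpose_mul_self {x y p q h : ℝ} (hxy : x ^ 2 + y ^ 2 = 1)
    (hpq : p ^ 2 + q ^ 2 = 1) (hh : 2 * h ^ 2 = 1) :
    (gluingMatrix x y p q h)ᵀ * gluingMatrix x y p q h = 1 := by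
  ext i j
  fin_cases i <;> fin_cases j <;>
    simp [gluingMatrix, Matrix.mul_apply, Fin.sum_univ_five] <;> grind

theorem symRealizable5_of_gluing {a b c d e x y p q : ℝ} (hx : 0 ≤ x) (hy : 0 ≤ y)
    (hp : 0 ≤ p) (hq : 0 ≤ q) (hxy : x ^ 2 + y ^ 2 = 1) (hpq : p ^ 2 + q ^ 2 = 1)
    (hab : b ≤ a)
    (h1 : |d| ≤ x ^ 2 * (p ^ 2 * a + q ^ 2 * b) + y ^ 2 * c)
    (h2 : c ≤ p ^ 2 * a + q ^ 2 * b)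
    (h3 : 0 ≤ y ^ 2 * (p ^ 2 * a + q ^ 2 * b) + x ^ 2 * c)
    (h4 : |e| ≤ q ^ 2 * a + p ^ 2 * b) :
    SymRealizable5 ![a, b, c, d, e] := by
  obtain ⟨h, hh0, hh⟩ : ∃ h : ℝ, 0 ≤ h ∧ 2 * h ^ 2 = 1 :=
    ⟨√(1 / 2), Real.sqrt_nonneg _, by rw [Real.sq_sqrt] <;> norm_num⟩
  refine ⟨gluingMatrix x y p q h * diagonal ![a, b, c, d, e] * (gluingMatrix x y p q h)ᵀ, ?_, ?_,
    charpoly_mul_diagonal_mul_transpose (gluingMatrix_transpose_mul_self hxy hpq hh) _⟩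
  · simp [Matrix.IsSymm, Matrix.transpose_mul, Matrix.mul_assoc]
  · rw [abs_le'] at h1 h4
    have hsq := sq_nonneg h
    have f1 := mul_nonneg hsq (sub_nonneg.2 h1.1)
    have f2 := mul_nonneg hsq (sub_nonneg.2 h1.2)
    have f3 := mul_nonneg (mul_nonneg hh0 (mul_nonneg hx hy)) (sub_nonneg.2 h2)
    have f4 := mul_nonneg (mul_nonneg hsq (mul_nonneg hx (mul_nonneg hp hq))) (sub_nonneg.2 hab)
    have f5 := mul_nonneg (mul_nonneg hh0 (mul_nonneg hy (mul_nonneg hp hq))) (sub_nonneg.2 hab)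
    have f6 := mul_nonneg hsq (sub_nonneg.2 h4.1)
    have f7 := mul_nonneg hsq (sub_nonneg.2 h4.2)
    intro i j
    fin_cases i <;> fin_cases j <;>
      simp [gluingMatrix, Matrix.mul_apply, Fin.sum_univ_five, vecMul_diagonal] <;> linarith

/-- Every `t ∈ [b, a]` is a convex combination with weights that are squares. -/
theorem exists_sq_weights {a b t : ℝ} (hb : b ≤ t) (ha : t ≤ a) :
    ∃ p q : ℝ, 0 ≤ p ∧ 0 ≤ q ∧ p ^ 2 + q ^ 2 = 1 ∧ p ^ 2 * a + q ^ 2 * b = t := by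
  have hmem : t ∈ segment ℝ a b := by
    rw [segment_symm, segment_eq_Icc (hb.trans ha)]
    exact ⟨hb, ha⟩
  obtain ⟨u, v, hu, hv, huv, ht⟩ := hmem
  refine ⟨√u, √v, Real.sqrt_nonneg _, Real.sqrt_nonneg _, ?_, ?_⟩ <;>
    rw [Real.sq_sqrt hu, Real.sq_sqrt hv]
  exacts [huv, ht]

theorem symRealizable5_of_sorted {a b c d e : ℝ} (hab : b ≤ a) (hbc : c ≤ b) (hcd : d ≤ c)
    (hde : e ≤ d) (hae : 0 ≤ a + e) (hsum : 0 ≤ a + b + c + d + e)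
    (hc : c ≤ a + b + c + d + e) (hacd : 0 ≤ a + c + d) :
    SymRealizable5 ![a, b, c, d, e] := by
  obtain ⟨β, hβb, hβe, hβ⟩ : ∃ β, b ≤ β ∧ -e ≤ β ∧ (β = b ∨ β = -e) :=
    ⟨max b (-e), le_max_left _ _, le_max_right _ _, max_choice _ _⟩
  have hα1 : b ≤ a + b - β := by rcases hβ with rfl | rfl <;> linarith
  obtain ⟨p, q, hp, hq, hpq, hα⟩ := exists_sq_weights hα1 (by linarith : a + b - β ≤ a)
  have hβ' : q ^ 2 * a + p ^ 2 * b = β := by linear_combination (a + b) * hpq - hα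
  have h4 : |e| ≤ q ^ 2 * a + p ^ 2 * b := by rw [hβ', abs_le]; constructor <;> linarith
  rcases le_total c 0 with hc0 | hc0
  · have hαcd : 0 ≤ a + b - β + c + d := by rcases hβ with rfl | rfl <;> linarith
    obtain ⟨x, y, hx, hy, hxy, hd⟩ :=
      exists_sq_weights (by linarith : c ≤ -d) (by linarith : -d ≤ a + b - β)
    refine symRealizable5_of_gluing hx hy hp hq hxy hpq hab ?_ ?_ ?_ h4 <;> rw [hα]
    · rw [hd, abs_of_nonpos (hcd.trans hc0)]
    · linarith
    · have : y ^ 2 * (a + b - β) + x ^ 2 * c = a + b - β + c + d := by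
        linear_combination (a + b - β + c) * hxy - hd
      rwa [this]
  · have hαd : 0 ≤ a + b - β + d := by rcases hβ with rfl | rfl <;> linarith
    refine symRealizable5_of_gluing zero_le_one le_rfl hp hq (by norm_num) hpq hab ?_ ?_ ?_ h4 <;>
      rw [hα]
    · rw [abs_le]; constructor <;> linarith
    · linarith
    · linarith

theorem SymRealizable5.of_prod_eq {μ ν : Fin 5 → ℝ} (h : SymRealizable5 μ)
    (hμν : ∏ j, (X - C (μ j)) = ∏ j, (X - C (ν j))) : SymRealizable5 ν := by
  obtain ⟨A, hs, hn, hA⟩ := h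
  exact ⟨A, hs, hn, hA.trans hμν⟩

/-- Sufficient conditions when one entry `t` has not yet been sorted into the tail. -/
theorem symRealizable5_of_insert {a b c d t : ℝ} {ν : Fin 5 → ℝ} (hab : b ≤ a) (hbc : c ≤ b)
    (hcd : d ≤ c) (hta : t ≤ a) (had : 0 ≤ a + d) (hat : 0 ≤ a + t)
    (hsum : 0 ≤ a + b + c + d + t) (hc : c ≤ a + b + c + d + t)
    (ht : b ≤ a + b + c + d + t ∨ t ≤ a + b + c + d + t)
    (hacd : 0 ≤ a + c + d ∨ 0 ≤ a + c + t) (habc : 0 ≤ a + b + c)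
    (hν : (X - C a) * (X - C b) * (X - C c) * (X - C d) * (X - C t) = ∏ j, (X - C (ν j))) :
    SymRealizable5 ν := by
  rcases le_total b t with hbt | hbt
  · refine (symRealizable5_of_sorted (a := a) (b := t) (c := b) (d := c) (e := d)
      ?_ ?_ ?_ ?_ ?_ ?_ ?_ ?_).of_prod_eq ?_
    on_goal 9 => rw [← hν]; simp [Fin.prod_univ_five]; ring
    all_goals grind
  rcases le_total c t with hct | hct
  · refine (symRealizable5_of_sorted (a := a) (b := b) (c := t) (d := c) (e := d)
      ?_ ?_ ?_ ?_ ?_ ?_ ?_ ?_).of_prod_eq ?_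
    on_goal 9 => rw [← hν]; simp [Fin.prod_univ_five]; ring
    all_goals grind
  rcases le_total d t with hdt | hdt
  · refine (symRealizable5_of_sorted (a := a) (b := b) (c := c) (d := t) (e := d)
      ?_ ?_ ?_ ?_ ?_ ?_ ?_ ?_).of_prod_eq ?_
    on_goal 9 => rw [← hν]; simp [Fin.prod_univ_five]; ring
    all_goals grind
  · refine (symRealizable5_of_sorted (a := a) (b := b) (c := c) (d := d) (e := t)
      ?_ ?_ ?_ ?_ ?_ ?_ ?_ ?_).of_prod_eq ?_
    on_goal 9 => rw [← hν]; simp [Fin.prod_univ_five]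
    all_goals grind

theorem stmt12 (μ : Fin 5 → ℝ)
    (hdec : ∀ j k : Fin 5, j ≤ k → μ k ≤ μ j) (hlow : μ 4 ≥ -μ 0)
    (h3 : μ 2 ≤ μ 0 + μ 1 + μ 2 + μ 3 + μ 4)
    (hreal : SymRealizable5 μ)
    (s : ℝ) (hs : 0 < s) (i : Fin 5) (hi : i ≠ 0) :
    SymRealizable5 (Function.update (Function.update μ 0 (μ 0 + s)) i (μ i - s)) ∧
    SymRealizable5 (Function.update (Function.update μ 0 (μ 0 + s)) i (μ i + s)) := by
  have h01 := hdec 0 1 (by decide)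
  have h12 := hdec 1 2 (by decide)
  have h23 := hdec 2 3 (by decide)
  have h34 := hdec 3 4 (by decide)
  obtain ⟨A, hA, hnn, hchar⟩ := hreal
  have htr := trace_eq_sum_of_charpoly hchar
  have htr0 : 0 ≤ A.trace := Finset.sum_nonneg fun k _ ↦ hnn k k
  have h14 := second_add_last_le_trace hA hnn (fun j k h ↦ hdec j k h) hchar
  rw [Fin.sum_univ_five] at htr
  have key (δ : ℝ) (hδ : -s ≤ δ) (hδ' : δ ≤ s) :
      SymRealizable5 (Function.update (Function.update μ 0 (μ 0 + s)) i (μ i + δ)) := by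
    fin_cases i
    · exact absurd rfl hi
    · refine symRealizable5_of_insert (a := μ 0 + s) (b := μ 2) (c := μ 3) (d := μ 4)
        (t := μ 1 + δ) ?_ ?_ ?_ ?_ ?_ ?_ ?_ ?_ ?_ ?_ ?_ ?_
      on_goal 12 => simp [Fin.prod_univ_five]; ring
      all_goals grind
    · refine symRealizable5_of_insert (a := μ 0 + s) (b := μ 1) (c := μ 3) (d := μ 4)
        (t := μ 2 + δ) ?_ ?_ ?_ ?_ ?_ ?_ ?_ ?_ ?_ ?_ ?_ ?_
      on_goal 12 => simp [Fin.prod_univ_five]; ring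
      all_goals grind
    · refine symRealizable5_of_insert (a := μ 0 + s) (b := μ 1) (c := μ 2) (d := μ 4)
        (t := μ 3 + δ) ?_ ?_ ?_ ?_ ?_ ?_ ?_ ?_ ?_ ?_ ?_ ?_
      on_goal 12 => simp [Fin.prod_univ_five]; ring
      all_goals grind
    · refine symRealizable5_of_insert (a := μ 0 + s) (b := μ 1) (c := μ 2) (d := μ 3)
        (t := μ 4 + δ) ?_ ?_ ?_ ?_ ?_ ?_ ?_ ?_ ?_ ?_ ?_ ?_
      on_goal 12 => simp [Fin.prod_univ_five]
      all_goals grind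
  exact ⟨by simpa only [sub_eq_add_neg] using key (-s) le_rfl (by linarith),
    key s (by linarith) le_rfl⟩
end

section
/- Let σ = (λ₁,...,λ₅) be real numbers with λ₁ ≥ λ₂ ≥ λ₃ ≥ λ₄ ≥ λ₅ > -λ₁, e₁(σ) ≥ 0, λ₃ > e₁(σ), and r(σ) ≥ 0. For s > 0 small enough, the list σ₃^{-s} = (λ₁+s, λ₂, λ₃-s, λ₄, λ₅) satisfies r(σ₃^{-s}) - r(σ) = -s(λ₂+λ₄+λ₅)(s+λ₁-λ₃) > 0. -/
/-- `r(σ) = e₃(σ) + e₁(σ)(λ₂² + λ₅²)` as a function of the five entries. -/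
def rFun (l1 l2 l3 l4 l5 : ℝ) : ℝ :=
  (l1*l2*l3+l1*l2*l4+l1*l2*l5+l1*l3*l4+l1*l3*l5+l1*l4*l5+l2*l3*l4+l2*l3*l5+l2*l4*l5+l3*l4*l5)
    + (l1 + l2 + l3 + l4 + l5) * (l2^2 + l5^2)

theorem stmt14 (l1 l2 l3 l4 l5 : ℝ)
    (h12 : l1 ≥ l2) (h23 : l2 ≥ l3) (h34 : l3 ≥ l4) (h45 : l4 ≥ l5) (h5 : l5 > -l1)
    (he1 : l1 + l2 + l3 + l4 + l5 ≥ 0)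
    (h3 : l3 > l1 + l2 + l3 + l4 + l5)
    (hr : rFun l1 l2 l3 l4 l5 ≥ 0) :
    ∃ s₀ > 0, ∀ s : ℝ, 0 < s → s < s₀ →
      rFun (l1 + s) l2 (l3 - s) l4 l5 - rFun l1 l2 l3 l4 l5
        = -s * (l2 + l4 + l5) * (s + l1 - l3) ∧
      -s * (l2 + l4 + l5) * (s + l1 - l3) > 0 := by
  refine ⟨1, one_pos, fun s hs _ => ⟨by unfold rFun; ring, ?_⟩⟩
  have hsum : l2 + l4 + l5 < 0 := by linarith
  have hgap : 0 < s + l1 - l3 := by linarith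
  exact mul_pos (mul_pos_of_neg_of_neg (neg_neg_of_pos hs) hsum) hgap
end

section
/- The list σ = (1000, 381, 360, -641, -750) satisfies e₁(σ) = 350, λ₃ = 360 > e₁(σ), r(σ) = e₃(σ) + e₁(σ)(λ₂²+λ₅²) = 306540 > 0, and λ₅ > -λ₁; hence σ is the spectrum of a 5×5 symmetric nonnegative matrix, even though λ₃ exceeds the trace. -/
open Polynomial

/-- A symmetric pattern, invariant under the reflection that exchanges the indices `1, 2` and
`3, 4`. -/
def reflectionPattern (a p y b c : ℝ) : Matrix (Fin 5) (Fin 5) ℝ :=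
  !![a, p, p, 0, 0;
     p, 0, y, b, 0;
     p, y, 0, 0, b;
     0, b, 0, 0, c;
     0, 0, b, c, 0]

theorem reflectionPattern_isSymm (a p y b c : ℝ) : (reflectionPattern a p y b c).IsSymm := by
  ext i j
  fin_cases i <;> fin_cases j <;> rfl

theorem reflectionPattern_nonneg {a p y b c : ℝ} (ha : 0 ≤ a) (hp : 0 ≤ p) (hy : 0 ≤ y)
    (hb : 0 ≤ b) (hc : 0 ≤ c) (i j : Fin 5) : 0 ≤ reflectionPattern a p y b c i j := by
  fin_cases i <;> fin_cases j <;> simp [reflectionPattern, *]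

/-- The characteristic polynomial splits into an antisymmetric and a symmetric factor. -/
theorem reflectionPattern_charpoly_eval (a p y b c x : ℝ) :
    (reflectionPattern a p y b c).charpoly.eval x =
      ((x + y) * (x + c) - b ^ 2) *
        ((x - a) * ((x - y) * (x - c) - b ^ 2) - 2 * p ^ 2 * (x - c)) := by
  rw [Matrix.eval_charpoly]
  simp [reflectionPattern, Matrix.det_succ_row_zero, Fin.sum_univ_succ, Fin.succAbove,
    Matrix.scalar_apply, Matrix.diagonal_apply]
  ring

theorem stmt19 :
    let l1 : ℝ := 1000; let l2 : ℝ := 381; let l3 : ℝ := 360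
    let l4 : ℝ := -641; let l5 : ℝ := -750
    l1 + l2 + l3 + l4 + l5 = 350 ∧
    l3 > l1 + l2 + l3 + l4 + l5 ∧
    (l1*l2*l3+l1*l2*l4+l1*l2*l5+l1*l3*l4+l1*l3*l5+l1*l4*l5+l2*l3*l4+l2*l3*l5+l2*l4*l5+l3*l4*l5)
      + (l1 + l2 + l3 + l4 + l5) * (l2^2 + l5^2) = 306540 ∧
    l5 > -l1 ∧
    ∃ A : Matrix (Fin 5) (Fin 5) ℝ, A.IsSymm ∧ (∀ i j, 0 ≤ A i j) ∧
      A.charpoly = (X - C l1) * (X - C l2) * (X - C l3) * (X - C l4) * (X - C l5) := by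
  intro l1 l2 l3 l4 l5
  refine ⟨by norm_num [l1, l2, l3, l4, l5], by norm_num [l1, l2, l3, l4, l5],
    by norm_num [l1, l2, l3, l4, l5], by norm_num [l1, l5],
    reflectionPattern 350 √177580 (15327 / 17758)
      √(285750 + 15327 / 17758 * (6537375 / 17758)) (6537375 / 17758),
    reflectionPattern_isSymm .., reflectionPattern_nonneg (by norm_num) (Real.sqrt_nonneg _)
      (by norm_num) (Real.sqrt_nonneg _) (by norm_num), Polynomial.funext fun x ↦ ?_⟩
  rw [reflectionPattern_charpoly_eval, Real.sq_sqrt (by norm_num), Real.sq_sqrt (by norm_num)]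
  simp only [eval_mul, eval_sub, eval_X, eval_C, l1, l2, l3, l4, l5]
  ring
end
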